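/- Let (Π,<) be a statically ordered logic program and X a consistent set of literals. Then X is a <-preserving answer set of Π if and only if X = Y ∩ 𝓛_𝒜 for some answer set Y of 𝒯(Π,<), where 𝓛_𝒜 denotes the set of literals over the regular atoms 𝒜. -/

import Mathlib

set_option autoImplicit false

namespace ASP

/-- Literals over a set of atoms: an atom or its classical negation. -/
inductive Lit (α : Type) : Type
  | pos : α → Lit α
  | neg : α → Lit α

namespace Lit

/-- The atom of a literal. -/
def atom {α : Type} : Lit α → α
  | pos a => a
  | neg a => a

/-- Map a function over the atom of a literal. -/
def map {α β : Type} (f : α → β) : Lit α → Lit β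
  | pos a => pos (f a)
  | neg a => neg (f a)

end Lit

/-- A rule `head ← bodyP, not bodyN`. -/
structure Rule (α : Type) : Type where
  head : Lit α
  bodyP : Set (Lit α)
  bodyN : Set (Lit α)

/-- Map a function over the atoms of a rule. -/
def Rule.map {α β : Type} (f : α → β) (r : Rule α) : Rule β :=
  ⟨r.head.map f, Lit.map f '' r.bodyP, Lit.map f '' r.bodyN⟩

/-- The literals occurring in a rule. -/
def ruleLits {α : Type} (r : Rule α) : Set (Lit α) := insert r.head (r.bodyP ∪ r.bodyN)

/-- A set of literals is consistent iff it contains no complementary pair. -/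
def consistent {α : Type} (X : Set (Lit α)) : Prop := ¬ ∃ a, Lit.pos a ∈ X ∧ Lit.neg a ∈ X

/-- Logically closed: consistent or the set of all literals. -/
def logClosed {α : Type} (X : Set (Lit α)) : Prop := consistent X ∨ X = Set.univ

/-- The smallest logically closed set of literals containing `S`. -/
def logClosure {α : Type} (S : Set (Lit α)) : Set (Lit α) := ⋂₀ {Y | S ⊆ Y ∧ logClosed Y}

/-- `X` is closed under the (basic) program `P`. -/
def closedUnder {α : Type} (P : Set (Rule α)) (X : Set (Lit α)) : Prop :=
  ∀ r ∈ P, r.bodyP ⊆ X → r.head ∈ X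

/-- `Th P`: smallest set which is logically closed and closed under the basic program `P`. -/
def Th {α : Type} (P : Set (Rule α)) : Set (Lit α) := ⋂₀ {X | logClosed X ∧ closedUnder P X}

/-- A rule is defeated by `X` iff `bodyN r ∩ X ≠ ∅`. -/
def defeated {α : Type} (r : Rule α) (X : Set (Lit α)) : Prop := ∃ L ∈ r.bodyN, L ∈ X

/-- The Gelfond-Lifschitz reduct of `P` relative to `X`. -/
def reduct {α : Type} (P : Set (Rule α)) (X : Set (Lit α)) : Set (Rule α) :=
  {r' | ∃ r ∈ P, ¬ defeated r X ∧ r' = Rule.mk r.head r.bodyP ∅}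

/-- `X` is an answer set of `P` iff `Th (P^X) = X`. -/
def answerSet {α : Type} (P : Set (Rule α)) (X : Set (Lit α)) : Prop := Th (reduct P X) = X

/-- Generating rules of `X` from `P`. -/
def GR {α : Type} (P : Set (Rule α)) (X : Set (Lit α)) : Set (Rule α) :=
  {r | r ∈ P ∧ r.bodyP ⊆ X ∧ ¬ defeated r X}

/-- Heads of the rules occurring before position `i` in the list `l`. -/
def headsBefore {α : Type} (l : List (Rule α)) (i : ℕ) : Set (Lit α) :=
  {L | L ∈ (l.take i).map Rule.head}

/-- The sequence of rules `l` is grounded. -/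
def groundedList {α : Type} (l : List (Rule α)) : Prop :=
  ∀ (i : ℕ) (h : i < l.length),
    consistent (headsBefore l i) → (l.get ⟨i, h⟩).bodyP ⊆ headsBefore l i

/-- `l` is an enumeration of the set `S` of rules. -/
def enumerates {α : Type} (l : List (Rule α)) (S : Set (Rule α)) : Prop :=
  l.Nodup ∧ {r | r ∈ l} = S

/-- The one-step consequence operator for basic programs. -/
def TOp {α : Type} (P : Set (Rule α)) (X : Set (Lit α)) : Set (Lit α) :=
  {L | (consistent X ∧ ∃ r ∈ P, r.bodyP ⊆ X ∧ r.head = L) ∨ ¬ consistent X}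

/-- Iterated application of `TOp`, starting from `∅`. -/
def TIter {α : Type} (P : Set (Rule α)) : ℕ → Set (Lit α)
  | 0 => ∅
  | n + 1 => TOp P (TIter P n)

/-- A strict partial order whose field is contained in `P`. -/
def strictOn {γ : Type} (P : Set γ) (lt : γ → γ → Prop) : Prop :=
  (∀ a b, lt a b → a ∈ P ∧ b ∈ P) ∧ (∀ a b c, lt a b → lt b c → lt a c) ∧ (∀ a, ¬ lt a a)

/-- A total strict order on `P`. -/
def totalStrictOn {γ : Type} (P : Set γ) (ll : γ → γ → Prop) : Prop :=
  (∀ a b, ll a b → a ∈ P ∧ b ∈ P) ∧ (∀ a b c, ll a b → ll b c → ll a c) ∧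
    (∀ a, ¬ ll a a) ∧ (∀ a ∈ P, ∀ b ∈ P, a ≠ b → ll a b ∨ ll b a)

/-! ## Ordered logic programs -/

/-- Atoms of the language of an ordered logic program: regular atoms and
preference atoms `n ≺ m` over names. -/
inductive OAtom (α N : Type) : Type
  | reg : α → OAtom α N
  | pref : N → N → OAtom α N

/-- Rules of an ordered logic program. -/
abbrev ORule (α N : Type) := Rule (OAtom α N)

/-- The preference literal `(n ≺ m)`. -/
def prefLit {α N : Type} (n m : N) : Lit (OAtom α N) := Lit.pos (OAtom.pref n m)

/-- A literal over a regular atom. -/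
def regLitO {α N : Type} (L : Lit (OAtom α N)) : Prop := ∃ a, L.atom = OAtom.reg a

/-- No preference atom occurs in the rule `r`. -/
def noPref {α N : Type} (r : ORule α N) : Prop := ∀ L ∈ ruleLits r, regLitO L

/-- The dynamically induced preference `r <_X r'`, at the level of the language `𝓛`. -/
def precXO {α N : Type} (nm : ORule α N → N) (X : Set (Lit (OAtom α N)))
    (r s : ORule α N) : Prop :=
  prefLit (nm r) (nm s) ∈ X

/-- The fact `(n_r ≺ n_s) ←`. -/
def prefFactO {α N : Type} (nm : ORule α N → N) (r s : ORule α N) : ORule α N :=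
  ⟨prefLit (nm r) (nm s), ∅, ∅⟩

/-- The transitivity rule `t(r,s,t)`. -/
def tRuleO {α N : Type} (nm : ORule α N → N) (r s t : ORule α N) : ORule α N :=
  ⟨prefLit (nm r) (nm t), {prefLit (nm r) (nm s), prefLit (nm s) (nm t)}, ∅⟩

/-- The antisymmetry rule `as(r,s)`. -/
def asRuleO {α N : Type} (nm : ORule α N → N) (r s : ORule α N) : ORule α N :=
  ⟨Lit.neg (OAtom.pref (nm s) (nm r)), {prefLit (nm r) (nm s)}, ∅⟩

/-- `TA(Π)`: `Π` together with all transitivity and antisymmetry rules. -/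
def TA {α N : Type} (P : Set (ORule α N)) (nm : ORule α N → N) : Set (ORule α N) :=
  P ∪ {ru | ∃ r ∈ P, ∃ s ∈ P, ∃ t ∈ P, ru = tRuleO nm r s t}
    ∪ {ru | ∃ r ∈ P, ∃ s ∈ P, ru = asRuleO nm r s}

/-- The statically ordered program `(Π,<)`, identified with
`Π ∪ {(n_r ≺ n_{r'}) ← ∣ r < r'}`. -/
def staticProg {α N : Type} (P : Set (ORule α N)) (nm : ORule α N → N)
    (lt : ORule α N → ORule α N → Prop) : Set (ORule α N) :=
  P ∪ {ru | ∃ r ∈ P, ∃ s ∈ P, lt r s ∧ ru = prefFactO nm r s}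

/-- The heads of the generating rules occurring before position `i` in `l`. -/
def grHeadsBefore {α : Type} (l : List (Rule α)) (G : Set (Rule α)) (i : ℕ) :
    Set (Lit α) :=
  {L | ∃ j, ∃ h : j < l.length, j < i ∧ l.get ⟨j, h⟩ ∈ G ∧ (l.get ⟨j, h⟩).head = L}

/-- `X` is a `<`-preserving answer set of the statically ordered program `(P,lt)`
(Definition 1). -/
def staticPreserving {α N : Type} (P : Set (ORule α N))
    (lt : ORule α N → ORule α N → Prop) (X : Set (Lit (OAtom α N))) : Prop :=
  answerSet P X ∧ consistent X ∧
    ∃ l : List (ORule α N), enumerates l (GR P X) ∧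
      (∀ (i : ℕ) (h : i < l.length), (l.get ⟨i, h⟩).bodyP ⊆ headsBefore l i) ∧
      (∀ (i j : ℕ) (hi : i < l.length) (hj : j < l.length),
        lt (l.get ⟨i, hi⟩) (l.get ⟨j, hj⟩) → j < i) ∧
      (∀ (i : ℕ) (hi : i < l.length), ∀ r' ∈ P, r' ∉ GR P X →
        lt (l.get ⟨i, hi⟩) r' →
          ¬ r'.bodyP ⊆ X ∨ ∃ L ∈ r'.bodyN, L ∈ headsBefore l i)

/-- `X` is a `<_X`-preserving answer set of the program `P` (standing for `TA(Π)`;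
Definition 3). -/
def dynPreserving {α N : Type} (nm : ORule α N → N) (P : Set (ORule α N))
    (X : Set (Lit (OAtom α N))) : Prop :=
  answerSet P X ∧ consistent X ∧
    ∃ l : List (ORule α N), enumerates l P ∧
      (∀ (i j : ℕ) (hi : i < l.length) (hj : j < l.length),
        precXO nm X (l.get ⟨i, hi⟩) (l.get ⟨j, hj⟩) → j < i) ∧
      (∀ (i j : ℕ) (hi : i < l.length) (hj : j < l.length),
        precXO nm X (l.get ⟨i, hi⟩) (l.get ⟨j, hj⟩) →
          ∃ k, ∃ hk : k < l.length, k < i ∧ l.get ⟨k, hk⟩ ∈ GR P X ∧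
            (l.get ⟨k, hk⟩).head = prefLit (nm (l.get ⟨i, hi⟩)) (nm (l.get ⟨j, hj⟩))) ∧
      (∀ (i : ℕ) (hi : i < l.length), l.get ⟨i, hi⟩ ∈ GR P X →
        (l.get ⟨i, hi⟩).bodyP ⊆ grHeadsBefore l (GR P X) i) ∧
      (∀ (i : ℕ) (hi : i < l.length), l.get ⟨i, hi⟩ ∉ GR P X →
        ¬ (l.get ⟨i, hi⟩).bodyP ⊆ X ∨
          ∃ L ∈ (l.get ⟨i, hi⟩).bodyN, L ∈ grHeadsBefore l (GR P X) i)

/-- Occurrence of a name in a rule (inside some preference atom). -/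
def nameOccurs {α N : Type} (n : N) (r : ORule α N) : Prop :=
  ∃ L ∈ ruleLits r, ∃ m, L.atom = OAtom.pref n m ∨ L.atom = OAtom.pref m n

/-! ## The translation 𝒯 -/

/-- Atoms of the target language `𝓛⁺` of the translation `𝒯`. -/
inductive TAtom (α N : Type) : Type
  | old : OAtom α N → TAtom α N
  | ap : N → TAtom α N
  | bl : N → TAtom α N
  | ok : N → TAtom α N
  | rdy : N → N → TAtom α N

/-- Embedding of `𝓛`-literals into `𝓛⁺`. -/
def oldLit {α N : Type} (L : Lit (OAtom α N)) : Lit (TAtom α N) := L.map TAtom.old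

/-- The preference literal `(n ≺ m)` inside `𝓛⁺`. -/
def tpref {α N : Type} (n m : N) : Lit (TAtom α N) := Lit.pos (TAtom.old (OAtom.pref n m))

def apLit {α N : Type} (n : N) : Lit (TAtom α N) := Lit.pos (TAtom.ap n)
def blLit {α N : Type} (n : N) : Lit (TAtom α N) := Lit.pos (TAtom.bl n)
def okLit {α N : Type} (n : N) : Lit (TAtom α N) := Lit.pos (TAtom.ok n)
def rdyLit {α N : Type} (n m : N) : Lit (TAtom α N) := Lit.pos (TAtom.rdy n m)

/-- `a1(r) : head(r) ← ap(n_r)`. -/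
def a1Rule {α N : Type} (nm : ORule α N → N) (r : ORule α N) : Rule (TAtom α N) :=
  ⟨oldLit r.head, {apLit (nm r)}, ∅⟩

/-- `a2(r) : ap(n_r) ← ok(n_r), body(r)`. -/
def a2Rule {α N : Type} (nm : ORule α N → N) (r : ORule α N) : Rule (TAtom α N) :=
  ⟨apLit (nm r), insert (okLit (nm r)) (oldLit '' r.bodyP), oldLit '' r.bodyN⟩

/-- `b1(r,L⁺) : bl(n_r) ← ok(n_r), not L⁺`. -/
def b1Rule {α N : Type} (nm : ORule α N → N) (r : ORule α N) (L : Lit (OAtom α N)) :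
    Rule (TAtom α N) :=
  ⟨blLit (nm r), {okLit (nm r)}, {oldLit L}⟩

/-- `b2(r,L⁻) : bl(n_r) ← ok(n_r), L⁻`. -/
def b2Rule {α N : Type} (nm : ORule α N → N) (r : ORule α N) (L : Lit (OAtom α N)) :
    Rule (TAtom α N) :=
  ⟨blLit (nm r), {okLit (nm r), oldLit L}, ∅⟩

/-- `c1(r) : ok(n_r) ← rdy(n_r,n_{r_1}), …, rdy(n_r,n_{r_k})`. -/
def c1Rule {α N : Type} (P : Set (ORule α N)) (nm : ORule α N → N) (r : ORule α N) :
    Rule (TAtom α N) :=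
  ⟨okLit (nm r), {L | ∃ s ∈ P, L = rdyLit (nm r) (nm s)}, ∅⟩

/-- `c2(r,s) : rdy(n_r,n_s) ← not (n_r ≺ n_s)`. -/
def c2Rule {α N : Type} (nm : ORule α N → N) (r s : ORule α N) : Rule (TAtom α N) :=
  ⟨rdyLit (nm r) (nm s), ∅, {tpref (nm r) (nm s)}⟩

/-- `c3(r,s) : rdy(n_r,n_s) ← (n_r ≺ n_s), ap(n_s)`. -/
def c3Rule {α N : Type} (nm : ORule α N → N) (r s : ORule α N) : Rule (TAtom α N) :=
  ⟨rdyLit (nm r) (nm s), {tpref (nm r) (nm s), apLit (nm s)}, ∅⟩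

/-- `c4(r,s) : rdy(n_r,n_s) ← (n_r ≺ n_s), bl(n_s)`. -/
def c4Rule {α N : Type} (nm : ORule α N → N) (r s : ORule α N) : Rule (TAtom α N) :=
  ⟨rdyLit (nm r) (nm s), {tpref (nm r) (nm s), blLit (nm s)}, ∅⟩

/-- `t(r,s,t) : (n_r ≺ n_t) ← (n_r ≺ n_s), (n_s ≺ n_t)` inside `𝓛⁺`. -/
def tRuleT {α N : Type} (nm : ORule α N → N) (r s t : ORule α N) : Rule (TAtom α N) :=
  ⟨tpref (nm r) (nm t), {tpref (nm r) (nm s), tpref (nm s) (nm t)}, ∅⟩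

/-- `as(r,s) : ¬(n_s ≺ n_r) ← (n_r ≺ n_s)` inside `𝓛⁺`. -/
def asRuleT {α N : Type} (nm : ORule α N → N) (r s : ORule α N) : Rule (TAtom α N) :=
  ⟨Lit.neg (TAtom.old (OAtom.pref (nm s) (nm r))), {tpref (nm r) (nm s)}, ∅⟩

/-- The set of rules `τ(r)` of Definition 2. -/
def tau {α N : Type} (P : Set (ORule α N)) (nm : ORule α N → N) (r : ORule α N) :
    Set (Rule (TAtom α N)) :=
  {a1Rule nm r, a2Rule nm r, c1Rule P nm r}
    ∪ {ru | ∃ L ∈ r.bodyP, ru = b1Rule nm r L}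
    ∪ {ru | ∃ L ∈ r.bodyN, ru = b2Rule nm r L}
    ∪ {ru | ∃ s ∈ P, ru = c2Rule nm r s ∨ ru = c3Rule nm r s ∨ ru = c4Rule nm r s}
    ∪ {ru | ∃ s ∈ P, ∃ t ∈ P, ru = tRuleT nm r s t}
    ∪ {ru | ∃ s ∈ P, ru = asRuleT nm r s}

/-- The translation `𝒯(Π) = ⋃_{r ∈ Π} τ(r)`. -/
def TTrans {α N : Type} (P : Set (ORule α N)) (nm : ORule α N → N) :
    Set (Rule (TAtom α N)) :=
  {ru | ∃ r ∈ P, ru ∈ tau P nm r}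

/-- `𝒯(Π,<)` for a statically ordered program. -/
def TStatic {α N : Type} (P : Set (ORule α N)) (nm : ORule α N → N)
    (lt : ORule α N → ORule α N → Prop) : Set (Rule (TAtom α N)) :=
  TTrans (staticProg P nm lt) nm

/-- The dynamically induced preference `r <_X r'` read off from an answer set of
the translated program. -/
def precX {α N : Type} (nm : ORule α N → N) (X : Set (Lit (TAtom α N)))
    (r s : ORule α N) : Prop :=
  tpref (nm r) (nm s) ∈ X

/-- The literals of `𝓛⁺` over regular atoms (the set `𝓛_𝒜`). -/
def regLitsT {α N : Type} : Set (Lit (TAtom α N)) :=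
  {L | ∃ a, L.atom = TAtom.old (OAtom.reg a)}

/-- The literals of `𝓛⁺` belonging to the original language `𝓛`. -/
def oldLitsT {α N : Type} : Set (Lit (TAtom α N)) := Set.range oldLit

/-- A rule of `𝒯(Π)` that is an "image" of `r ∈ Π`:
`a2(r)`, or `b1(r,L)`/`b2(r,L)` for some body literal `L` of `r`. -/
def imgRule {α N : Type} (nm : ORule α N → N) (r : ORule α N)
    (ru : Rule (TAtom α N)) : Prop :=
  ru = a2Rule nm r ∨ (∃ L ∈ r.bodyP, ru = b1Rule nm r L) ∨
    (∃ L ∈ r.bodyN, ru = b2Rule nm r L)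

/-! ## The translation 𝒰 (Brewka–Eiter encoding) -/

/-- Atoms of the target language `𝓛°` of the translation `𝒰`. -/
inductive UAtom (α N : Type) : Type
  | old : OAtom α N → UAtom α N
  | pr : OAtom α N → UAtom α N
  | ap : N → UAtom α N
  | bl : N → UAtom α N
  | ok : N → UAtom α N
  | rdy : N → N → UAtom α N
  | de : N → UAtom α N

def uold {α N : Type} (L : Lit (OAtom α N)) : Lit (UAtom α N) := L.map UAtom.old
def uprimed {α N : Type} (L : Lit (OAtom α N)) : Lit (UAtom α N) := L.map UAtom.pr
def upref {α N : Type} (n m : N) : Lit (UAtom α N) := Lit.pos (UAtom.old (OAtom.pref n m))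
def uapLit {α N : Type} (n : N) : Lit (UAtom α N) := Lit.pos (UAtom.ap n)
def ublLit {α N : Type} (n : N) : Lit (UAtom α N) := Lit.pos (UAtom.bl n)
def uokLit {α N : Type} (n : N) : Lit (UAtom α N) := Lit.pos (UAtom.ok n)
def urdyLit {α N : Type} (n m : N) : Lit (UAtom α N) := Lit.pos (UAtom.rdy n m)
def udeLit {α N : Type} (n : N) : Lit (UAtom α N) := Lit.pos (UAtom.de n)

/-- `a1(r) : head(r') ← ap(n_r)`. -/
def ua1 {α N : Type} (nm : ORule α N → N) (r : ORule α N) : Rule (UAtom α N) :=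
  ⟨uprimed r.head, {uapLit (nm r)}, ∅⟩

/-- `a2(r) : ap(n_r) ← ok(n_r), body(r), not body⁻(r')`. -/
def ua2 {α N : Type} (nm : ORule α N → N) (r : ORule α N) : Rule (UAtom α N) :=
  ⟨uapLit (nm r), insert (uokLit (nm r)) (uold '' r.bodyP),
    uold '' r.bodyN ∪ uprimed '' r.bodyN⟩

/-- `b1(r,L) : bl(n_r) ← ok(n_r), not L, not L'`. -/
def ub1 {α N : Type} (nm : ORule α N → N) (r : ORule α N) (L : Lit (OAtom α N)) :
    Rule (UAtom α N) :=
  ⟨ublLit (nm r), {uokLit (nm r)}, {uold L, uprimed L}⟩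

/-- `b2(r,K) : bl(n_r) ← ok(n_r), K, K'`. -/
def ub2 {α N : Type} (nm : ORule α N → N) (r : ORule α N) (K : Lit (OAtom α N)) :
    Rule (UAtom α N) :=
  ⟨ublLit (nm r), {uokLit (nm r), uold K, uprimed K}, ∅⟩

/-- `c1(r) : ok(n_r) ← rdy(n_r,n_{r_1}), …, rdy(n_r,n_{r_k})`. -/
def uc1 {α N : Type} (P : Set (ORule α N)) (nm : ORule α N → N) (r : ORule α N) :
    Rule (UAtom α N) :=
  ⟨uokLit (nm r), {L | ∃ s ∈ P, L = urdyLit (nm r) (nm s)}, ∅⟩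

/-- `c2(r,s) : rdy(n_r,n_s) ← not (n_r ≺ n_s)`. -/
def uc2 {α N : Type} (nm : ORule α N → N) (r s : ORule α N) : Rule (UAtom α N) :=
  ⟨urdyLit (nm r) (nm s), ∅, {upref (nm r) (nm s)}⟩

/-- `c3(r,s) : rdy(n_r,n_s) ← (n_r ≺ n_s), ap(n_s)`. -/
def uc3 {α N : Type} (nm : ORule α N → N) (r s : ORule α N) : Rule (UAtom α N) :=
  ⟨urdyLit (nm r) (nm s), {upref (nm r) (nm s), uapLit (nm s)}, ∅⟩

/-- `c4(r,s) : rdy(n_r,n_s) ← (n_r ≺ n_s), bl(n_s)`. -/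
def uc4 {α N : Type} (nm : ORule α N → N) (r s : ORule α N) : Rule (UAtom α N) :=
  ⟨urdyLit (nm r) (nm s), {upref (nm r) (nm s), ublLit (nm s)}, ∅⟩

/-- `c5(r,s,J) : rdy(n_r,n_s) ← head(s), J`. -/
def uc5 {α N : Type} (nm : ORule α N → N) (r s : ORule α N) (J : Lit (OAtom α N)) :
    Rule (UAtom α N) :=
  ⟨urdyLit (nm r) (nm s), {uold s.head, uold J}, ∅⟩

/-- The constraint `de(r) : ← not ok(n_r)`, rendered as
`p_r ← not ok(n_r), not p_r` for the fresh atom `p_r = de(n_r)`. -/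
def ude {α N : Type} (nm : ORule α N → N) (r : ORule α N) : Rule (UAtom α N) :=
  ⟨udeLit (nm r), ∅, {uokLit (nm r), udeLit (nm r)}⟩

/-- Transitivity rule inside `𝓛°`. -/
def utr {α N : Type} (nm : ORule α N → N) (r s t : ORule α N) : Rule (UAtom α N) :=
  ⟨upref (nm r) (nm t), {upref (nm r) (nm s), upref (nm s) (nm t)}, ∅⟩

/-- Antisymmetry rule inside `𝓛°`. -/
def uas {α N : Type} (nm : ORule α N → N) (r s : ORule α N) : Rule (UAtom α N) :=
  ⟨Lit.neg (UAtom.old (OAtom.pref (nm s) (nm r))), {upref (nm r) (nm s)}, ∅⟩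

/-- The set of rules `τ(r)` of Definition 8. -/
def utau {α N : Type} (P : Set (ORule α N)) (nm : ORule α N → N) (r : ORule α N) :
    Set (Rule (UAtom α N)) :=
  {ua1 nm r, ua2 nm r, uc1 P nm r, ude nm r}
    ∪ {ru | ∃ L ∈ r.bodyP, ru = ub1 nm r L}
    ∪ {ru | ∃ K ∈ r.bodyN, ru = ub2 nm r K}
    ∪ {ru | ∃ s ∈ P, ru = uc2 nm r s ∨ ru = uc3 nm r s ∨ ru = uc4 nm r s}
    ∪ {ru | ∃ s ∈ P, ∃ J ∈ s.bodyN, ru = uc5 nm r s J}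
    ∪ {ru | ∃ s ∈ P, ∃ t ∈ P, ru = utr nm r s t}
    ∪ {ru | ∃ s ∈ P, ru = uas nm r s}

/-- The translation `𝒰(Π) = Π ∪ ⋃_{r ∈ Π} τ(r)`. -/
def UTrans {α N : Type} (P : Set (ORule α N)) (nm : ORule α N → N) :
    Set (Rule (UAtom α N)) :=
  (Rule.map UAtom.old) '' P ∪ {ru | ∃ r ∈ P, ru ∈ utau P nm r}

/-- The fact `(n_r ≺ n_s) ←` inside `𝓛°`. -/
def uPrefFact {α N : Type} (nm : ORule α N → N) (r s : ORule α N) : Rule (UAtom α N) :=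
  ⟨upref (nm r) (nm s), ∅, ∅⟩

/-- The literals of `𝓛°` over regular atoms (the set `𝓛_𝒜`). -/
def regLitsU {α N : Type} : Set (Lit (UAtom α N)) :=
  {L | ∃ a, L.atom = UAtom.old (OAtom.reg a)}

/-! ## Brewka–Eiter preferred answer sets -/

/-- `reductBE r = head(r) ← not body⁻(r)`. -/
def reductBE {γ : Type} (r : Rule γ) : Rule γ := ⟨r.head, ∅, r.bodyN⟩

/-- The sequence `X_i` of Definition 5 (for the enumeration `l` and the set `X`). -/
def CSeq {γ : Type} (l : List (Rule γ)) (X : Set (Lit γ)) : ℕ → Set (Lit γ)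
  | 0 => ∅
  | i + 1 =>
    CSeq l X i ∪
      {L | ∃ h : i < l.length,
        ¬ defeated (l.get ⟨i, h⟩) (CSeq l X i) ∧
        ¬ ((l.get ⟨i, h⟩).head ∈ X ∧ defeated (l.get ⟨i, h⟩) X) ∧
        L = (l.get ⟨i, h⟩).head}

/-- The operator `C` of Definition 5. -/
def COp {γ : Type} (l : List (Rule γ)) (X : Set (Lit γ)) : Set (Lit γ) :=
  logClosure (⋃ i, CSeq l X i)

/-- `l` is the enumeration of `P` according to the total order `ll`
(most preferred rule first). -/
def descList {γ : Type} (l : List (Rule γ)) (P : Set (Rule γ))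
    (ll : Rule γ → Rule γ → Prop) : Prop :=
  enumerates l P ∧
    ∀ (i j : ℕ) (hi : i < l.length) (hj : j < l.length), i < j →
      ll (l.get ⟨j, hj⟩) (l.get ⟨i, hi⟩)

/-- `X` is the BE-preferred answer set of the fully ordered prerequisite-free
program `(P,ll)`. -/
def BEPrefPF {γ : Type} (P : Set (Rule γ)) (ll : Rule γ → Rule γ → Prop)
    (X : Set (Lit γ)) : Prop :=
  ∃ l, descList l P ll ∧ COp l X = X

/-- The program `Π_X` of Definition 7. -/
def PiX {γ : Type} (P : Set (Rule γ)) (X : Set (Lit γ)) : Set (Rule γ) :=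
  {r' | ∃ r ∈ P, r.bodyP ⊆ X ∧ r' = reductBE r}

/-- `r` is the `ll`-maximal rule of `P` whose BE-reduct is `a`. -/
def beMax {γ : Type} (P : Set (Rule γ)) (ll : Rule γ → Rule γ → Prop)
    (a r : Rule γ) : Prop :=
  r ∈ P ∧ reductBE r = a ∧ ∀ s ∈ P, reductBE s = a → s = r ∨ ll s r

/-- The inherited order `ll_X` of Definition 7. -/
def llX {γ : Type} (P : Set (Rule γ)) (ll : Rule γ → Rule γ → Prop)
    (a b : Rule γ) : Prop :=
  ∃ r1 r2, beMax P ll a r1 ∧ beMax P ll b r2 ∧ ll r1 r2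

/-- `X` is a BE-preferred answer set of the fully ordered program `(P,ll)`. -/
def BEPrefFull {γ : Type} (P : Set (Rule γ)) (ll : Rule γ → Rule γ → Prop)
    (X : Set (Lit γ)) : Prop :=
  answerSet P X ∧ BEPrefPF (PiX P X) (llX P ll) X

/-- `X` is a BE-preferred answer set of the statically ordered program `(P,lt)`. -/
def BEPreferred {γ : Type} (P : Set (Rule γ)) (lt : Rule γ → Rule γ → Prop)
    (X : Set (Lit γ)) : Prop :=
  ∃ ll, totalStrictOn P ll ∧ (∀ a b, lt a b → ll a b) ∧ BEPrefFull P ll X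


/-! ## Derivability -/

/-- The literals derivable from `R` when the negative bodies are ignored. -/
inductive Derives {γ : Type} (R : Set (Rule γ)) : Lit γ → Prop
  | intro (r : Rule γ) (hr : r ∈ R) (h : ∀ L ∈ r.bodyP, Derives R L) : Derives R r.head

/-- The rules of `P` not defeated by `X`. -/
def undefeated {γ : Type} (P : Set (Rule γ)) (X : Set (Lit γ)) : Set (Rule γ) :=
  {r | r ∈ P ∧ ¬ defeated r X}

theorem Derives.mono {γ : Type} {R S : Set (Rule γ)} (h : R ⊆ S) {L : Lit γ}
    (hL : Derives R L) : Derives S L := by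
  induction hL with
  | intro r hr _ ih => exact .intro r (h hr) ih

theorem Derives.exists_rule {γ : Type} {R : Set (Rule γ)} {L : Lit γ} (hL : Derives R L) :
    ∃ r ∈ R, r.head = L ∧ ∀ K ∈ r.bodyP, Derives R K := by
  cases hL with
  | intro r hr h => exact ⟨r, hr, rfl, h⟩

theorem consistent.subset {γ : Type} {X Y : Set (Lit γ)} (hY : consistent Y) (h : X ⊆ Y) :
    consistent X := fun ⟨a, ha, hb⟩ => hY ⟨a, h ha, h hb⟩

theorem closedUnder_reduct_iff {γ : Type} {P : Set (Rule γ)} {X Z : Set (Lit γ)} :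
    closedUnder (reduct P X) Z ↔ ∀ r ∈ undefeated P X, r.bodyP ⊆ Z → r.head ∈ Z := by
  constructor
  · intro h r hr hb
    exact h ⟨r.head, r.bodyP, ∅⟩ ⟨r, hr.1, hr.2, rfl⟩ hb
  · rintro h _ ⟨r, hr, hd, rfl⟩ hb
    exact h r ⟨hr, hd⟩ hb

theorem answerSet_iff_of_consistent {γ : Type} {P : Set (Rule γ)} {X : Set (Lit γ)}
    (hX : consistent X) :
    answerSet P X ↔ ∀ L, L ∈ X ↔ Derives (undefeated P X) L := by
  have hleast : ∀ Z, closedUnder (reduct P X) Z → {L | Derives (undefeated P X) L} ⊆ Z := by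
    intro Z hZ L hL
    rw [closedUnder_reduct_iff] at hZ
    induction hL with
    | intro r hr _ ih => exact hZ r hr ih
  have hclosed : closedUnder (reduct P X) {L | Derives (undefeated P X) L} :=
    closedUnder_reduct_iff.2 fun r hr hb => .intro r hr hb
  have hsub : {L | Derives (undefeated P X) L} ⊆ Th (reduct P X) :=
    Set.subset_sInter fun Z hZ => hleast Z hZ.2
  have hTh : consistent {L | Derives (undefeated P X) L} →
      Th (reduct P X) = {L | Derives (undefeated P X) L} := fun hc =>
    Set.Subset.antisymm (Set.sInter_subset_of_mem ⟨Or.inl hc, hclosed⟩) hsub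
  constructor
  · intro h L
    have hc : consistent {L | Derives (undefeated P X) L} :=
      hX.subset (hsub.trans h.subset)
    have : X = {L | Derives (undefeated P X) L} := h.symm.trans (hTh hc)
    exact Set.ext_iff.1 this L
  · intro h
    have he : X = {L | Derives (undefeated P X) L} := Set.ext h
    exact (hTh (he ▸ hX)).trans he.symm

/-- An inconsistent answer set is the set of all literals. -/
theorem answerSet.eq_univ {γ : Type} {P : Set (Rule γ)} {X : Set (Lit γ)}
    (h : answerSet P X) (hX : ¬ consistent X) : X = Set.univ := by
  refine Set.eq_univ_of_forall fun L => ?_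
  rw [← show Th (reduct P X) = X from h]
  rintro Z ⟨hZ | hZ, hc⟩
  · have hXZ : X ⊆ Z := by
      rw [← show Th (reduct P X) = X from h]
      exact Set.sInter_subset_of_mem ⟨Or.inl hZ, hc⟩
    exact absurd (hZ.subset hXZ) hX
  · exact hZ ▸ Set.mem_univ L

/-! ## Literals of the translated language -/

theorem Lit.map_injective {β γ : Type} {f : β → γ} (hf : Function.Injective f) :
    Function.Injective (Lit.map f) := by
  rintro (a | a) (b | b) h <;> simp_all [Lit.map] <;> exact hf h

theorem oldLit_injective {α N : Type} :
    Function.Injective (oldLit : Lit (OAtom α N) → Lit (TAtom α N)) :=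
  Lit.map_injective fun _ _ h => TAtom.old.inj h

theorem oldLit_mem_regLitsT {α N : Type} {L : Lit (OAtom α N)} :
    oldLit L ∈ regLitsT ↔ regLitO L := by
  rcases L with a | a <;> simp [oldLit, Lit.map, regLitsT, regLitO, Lit.atom]

/-! ## Derivations in the translated program -/

section Inversion

variable {α N : Type} {Q : Set (ORule α N)} {nm : ORule α N → N} {R : Set (Rule (TAtom α N))}

theorem mem_TTrans {ru : Rule (TAtom α N)} :
    ru ∈ TTrans Q nm ↔ ∃ r ∈ Q, ru = a1Rule nm r ∨ ru = a2Rule nm r ∨ ru = c1Rule Q nm r ∨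
      (∃ L ∈ r.bodyP, ru = b1Rule nm r L) ∨ (∃ L ∈ r.bodyN, ru = b2Rule nm r L) ∨
      (∃ s ∈ Q, ru = c2Rule nm r s) ∨ (∃ s ∈ Q, ru = c3Rule nm r s) ∨
      (∃ s ∈ Q, ru = c4Rule nm r s) ∨ (∃ s ∈ Q, ∃ t ∈ Q, ru = tRuleT nm r s t) ∨
      (∃ s ∈ Q, ru = asRuleT nm r s) := by
  simp only [TTrans, tau, Set.mem_ofPred_eq, Set.mem_union, Set.mem_insert_iff,
    Set.mem_singleton_iff]
  grind

theorem Derives.ap_inv (hR : R ⊆ TTrans Q nm) {n : N} (h : Derives R (apLit n)) :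
    ∃ r ∈ Q, nm r = n ∧ a2Rule nm r ∈ R ∧ Derives R (okLit n) ∧
      ∀ L ∈ r.bodyP, Derives R (oldLit L) := by
  obtain ⟨ru, hru, hhead, hb⟩ := h.exists_rule
  obtain ⟨r, hr, rfl | rfl | rfl | ⟨L, hL, rfl⟩ | ⟨L, hL, rfl⟩ | ⟨s, hs, rfl⟩ | ⟨s, hs, rfl⟩ |
    ⟨s, hs, rfl⟩ | ⟨s, hs, t, ht, rfl⟩ | ⟨s, hs, rfl⟩⟩ := mem_TTrans.1 (hR hru)
  case inr.inl =>
    obtain rfl : nm r = n := by simpa [a2Rule, apLit] using hhead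
    exact ⟨r, hr, rfl, hru, hb _ (Set.mem_insert _ _), fun L hL =>
      hb _ (Set.mem_insert_of_mem _ ⟨L, hL, rfl⟩)⟩
  case inl =>
    rcases hh : r.head with a | a <;> simp [a1Rule, oldLit, apLit, Lit.map, hh] at hhead
  all_goals
    simp [c1Rule, b1Rule, b2Rule, c2Rule, c3Rule, c4Rule, tRuleT, asRuleT, apLit, okLit, blLit,
      rdyLit, tpref] at hhead

theorem Derives.bl_inv (hR : R ⊆ TTrans Q nm) {n : N} (h : Derives R (blLit n)) :
    ∃ r ∈ Q, nm r = n ∧ ((∃ L ∈ r.bodyP, b1Rule nm r L ∈ R) ∨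
      ∃ L ∈ r.bodyN, Derives R (oldLit L)) := by
  obtain ⟨ru, hru, hhead, hb⟩ := h.exists_rule
  obtain ⟨r, hr, rfl | rfl | rfl | ⟨L, hL, rfl⟩ | ⟨L, hL, rfl⟩ | ⟨s, hs, rfl⟩ | ⟨s, hs, rfl⟩ |
    ⟨s, hs, rfl⟩ | ⟨s, hs, t, ht, rfl⟩ | ⟨s, hs, rfl⟩⟩ := mem_TTrans.1 (hR hru)
  case inr.inr.inr.inl =>
    obtain rfl : nm r = n := by simpa [b1Rule, blLit] using hhead
    exact ⟨r, hr, rfl, .inl ⟨L, hL, hru⟩⟩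
  case inr.inr.inr.inr.inl =>
    obtain rfl : nm r = n := by simpa [b2Rule, blLit] using hhead
    exact ⟨r, hr, rfl, .inr ⟨L, hL, hb _ (by simp [b2Rule])⟩⟩
  case inl =>
    rcases hh : r.head with a | a <;> simp [a1Rule, oldLit, blLit, Lit.map, hh] at hhead
  all_goals
    simp [a2Rule, c1Rule, c2Rule, c3Rule, c4Rule, tRuleT, asRuleT, apLit, okLit, blLit,
      rdyLit, tpref] at hhead

theorem Derives.ok_inv (hR : R ⊆ TTrans Q nm) {n : N} (h : Derives R (okLit n)) :
    ∀ s ∈ Q, Derives R (rdyLit n (nm s)) := by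
  obtain ⟨ru, hru, hhead, hb⟩ := h.exists_rule
  obtain ⟨r, hr, rfl | rfl | rfl | ⟨L, hL, rfl⟩ | ⟨L, hL, rfl⟩ | ⟨s, hs, rfl⟩ | ⟨s, hs, rfl⟩ |
    ⟨s, hs, rfl⟩ | ⟨s, hs, t, ht, rfl⟩ | ⟨s, hs, rfl⟩⟩ := mem_TTrans.1 (hR hru)
  case inr.inr.inl =>
    obtain rfl : nm r = n := by simpa [c1Rule, okLit] using hhead
    exact fun s hs => hb _ ⟨s, hs, rfl⟩
  case inl =>
    rcases hh : r.head with a | a <;> simp [a1Rule, oldLit, okLit, Lit.map, hh] at hhead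
  all_goals
    simp [a2Rule, b1Rule, b2Rule, c2Rule, c3Rule, c4Rule, tRuleT, asRuleT, apLit, okLit, blLit,
      rdyLit, tpref] at hhead

theorem Derives.rdy_inv (hR : R ⊆ TTrans Q nm) {n m : N} (h : Derives R (rdyLit n m)) :
    (∃ r s, nm r = n ∧ nm s = m ∧ c2Rule nm r s ∈ R) ∨ Derives R (apLit m) ∨
      Derives R (blLit m) := by
  obtain ⟨ru, hru, hhead, hb⟩ := h.exists_rule
  obtain ⟨r, hr, rfl | rfl | rfl | ⟨L, hL, rfl⟩ | ⟨L, hL, rfl⟩ | ⟨s, hs, rfl⟩ | ⟨s, hs, rfl⟩ |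
    ⟨s, hs, rfl⟩ | ⟨s, hs, t, ht, rfl⟩ | ⟨s, hs, rfl⟩⟩ := mem_TTrans.1 (hR hru)
  case inr.inr.inr.inr.inr.inl =>
    obtain ⟨rfl, rfl⟩ : nm r = n ∧ nm s = m := by simpa [c2Rule, rdyLit] using hhead
    exact .inl ⟨r, s, rfl, rfl, hru⟩
  case inr.inr.inr.inr.inr.inr.inl =>
    obtain ⟨rfl, rfl⟩ : nm r = n ∧ nm s = m := by simpa [c3Rule, rdyLit] using hhead
    exact .inr (.inl (hb _ (by simp [c3Rule])))
  case inr.inr.inr.inr.inr.inr.inr.inl =>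
    obtain ⟨rfl, rfl⟩ : nm r = n ∧ nm s = m := by simpa [c4Rule, rdyLit] using hhead
    exact .inr (.inr (hb _ (by simp [c4Rule])))
  case inl =>
    rcases hh : r.head with a | a <;> simp [a1Rule, oldLit, rdyLit, Lit.map, hh] at hhead
  all_goals
    simp [a2Rule, c1Rule, b1Rule, b2Rule, tRuleT, asRuleT, apLit, okLit, blLit,
      rdyLit, tpref] at hhead

theorem Derives.reg_inv (hR : R ⊆ TTrans Q nm) {L : Lit (OAtom α N)} (hL : regLitO L)
    (h : Derives R (oldLit L)) : ∃ r ∈ Q, r.head = L ∧ Derives R (apLit (nm r)) := by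
  obtain ⟨ru, hru, hhead, hb⟩ := h.exists_rule
  obtain ⟨a, ha⟩ := hL
  obtain ⟨r, hr, rfl | rfl | rfl | ⟨K, hK, rfl⟩ | ⟨K, hK, rfl⟩ | ⟨s, hs, rfl⟩ | ⟨s, hs, rfl⟩ |
    ⟨s, hs, rfl⟩ | ⟨s, hs, t, ht, rfl⟩ | ⟨s, hs, rfl⟩⟩ := mem_TTrans.1 (hR hru)
  case inl => exact ⟨r, hr, oldLit_injective hhead, hb _ rfl⟩
  all_goals
    rcases L with b | b <;> obtain rfl : b = _ := ha <;>
    simp [a2Rule, c1Rule, b1Rule, b2Rule, c2Rule, c3Rule, c4Rule, tRuleT, asRuleT, apLit, okLit,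
      blLit, rdyLit, tpref, oldLit, Lit.map] at hhead

end Inversion

section Construction

variable {α N : Type} {Q : Set (ORule α N)} {nm : ORule α N → N} {Y : Set (Lit (TAtom α N))}

theorem derives_head_of_ap {r : ORule α N} (hr : r ∈ Q)
    (h : Derives (undefeated (TTrans Q nm) Y) (apLit (nm r))) :
    Derives (undefeated (TTrans Q nm) Y) (oldLit r.head) :=
  .intro (a1Rule nm r) ⟨mem_TTrans.2 ⟨r, hr, by tauto⟩, by simp [defeated, a1Rule]⟩
    (by simpa [a1Rule] using h)

theorem derives_ap {r : ORule α N} (hr : r ∈ Q)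
    (hok : Derives (undefeated (TTrans Q nm) Y) (okLit (nm r)))
    (hP : ∀ L ∈ r.bodyP, Derives (undefeated (TTrans Q nm) Y) (oldLit L))
    (hN : ∀ L ∈ r.bodyN, oldLit L ∉ Y) :
    Derives (undefeated (TTrans Q nm) Y) (apLit (nm r)) :=
  .intro (a2Rule nm r)
    ⟨mem_TTrans.2 ⟨r, hr, by tauto⟩, by simpa [defeated, a2Rule] using hN⟩
    (by simpa [a2Rule] using ⟨hok, hP⟩)

theorem derives_bl_of_notMem {r : ORule α N} (hr : r ∈ Q)
    (hok : Derives (undefeated (TTrans Q nm) Y) (okLit (nm r)))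
    {L : Lit (OAtom α N)} (hL : L ∈ r.bodyP) (hY : oldLit L ∉ Y) :
    Derives (undefeated (TTrans Q nm) Y) (blLit (nm r)) :=
  .intro (b1Rule nm r L)
    ⟨mem_TTrans.2 ⟨r, hr, .inr (.inr (.inr (.inl ⟨L, hL, rfl⟩)))⟩,
      by simpa [defeated, b1Rule] using hY⟩
    (by simpa [b1Rule] using hok)

theorem derives_bl_of_derives {r : ORule α N} (hr : r ∈ Q)
    (hok : Derives (undefeated (TTrans Q nm) Y) (okLit (nm r)))
    {L : Lit (OAtom α N)} (hL : L ∈ r.bodyN)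
    (hY : Derives (undefeated (TTrans Q nm) Y) (oldLit L)) :
    Derives (undefeated (TTrans Q nm) Y) (blLit (nm r)) :=
  .intro (b2Rule nm r L)
    ⟨mem_TTrans.2 ⟨r, hr, .inr (.inr (.inr (.inr (.inl ⟨L, hL, rfl⟩))))⟩,
      by simp [defeated, b2Rule]⟩
    (by simpa [b2Rule] using ⟨hok, hY⟩)

theorem derives_rdy {r s : ORule α N} (hr : r ∈ Q) (hs : s ∈ Q)
    (h : tpref (nm r) (nm s) ∈ Y →
      Derives (undefeated (TTrans Q nm) Y) (tpref (nm r) (nm s)) ∧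
      (Derives (undefeated (TTrans Q nm) Y) (apLit (nm s)) ∨
        Derives (undefeated (TTrans Q nm) Y) (blLit (nm s)))) :
    Derives (undefeated (TTrans Q nm) Y) (rdyLit (nm r) (nm s)) := by
  by_cases hp : tpref (nm r) (nm s) ∈ Y
  · obtain ⟨hd, ha | hb⟩ := h hp
    · refine .intro (c3Rule nm r s) ⟨mem_TTrans.2 ⟨r, hr, ?_⟩, by simp [defeated, c3Rule]⟩
        (by simpa [c3Rule] using ⟨hd, ha⟩)
      exact .inr (.inr (.inr (.inr (.inr (.inr (.inl ⟨s, hs, rfl⟩))))))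
    · refine .intro (c4Rule nm r s) ⟨mem_TTrans.2 ⟨r, hr, ?_⟩, by simp [defeated, c4Rule]⟩
        (by simpa [c4Rule] using ⟨hd, hb⟩)
      exact .inr (.inr (.inr (.inr (.inr (.inr (.inr (.inl ⟨s, hs, rfl⟩)))))))
  · refine .intro (c2Rule nm r s)
      ⟨mem_TTrans.2 ⟨r, hr, ?_⟩, by simpa [defeated, c2Rule] using hp⟩ (by simp [c2Rule])
    exact .inr (.inr (.inr (.inr (.inr (.inl ⟨s, hs, rfl⟩)))))

theorem derives_ok {r : ORule α N} (hr : r ∈ Q)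
    (h : ∀ s ∈ Q, tpref (nm r) (nm s) ∈ Y →
      Derives (undefeated (TTrans Q nm) Y) (tpref (nm r) (nm s)) ∧
      (Derives (undefeated (TTrans Q nm) Y) (apLit (nm s)) ∨
        Derives (undefeated (TTrans Q nm) Y) (blLit (nm s)))) :
    Derives (undefeated (TTrans Q nm) Y) (okLit (nm r)) := by
  refine .intro (c1Rule Q nm r)
    ⟨mem_TTrans.2 ⟨r, hr, by tauto⟩, by simp [defeated, c1Rule]⟩ ?_
  rintro _ ⟨s, hs, rfl⟩
  exact derives_rdy hr hs (h s hs)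

theorem derives_neg_pref {r s : ORule α N} (hr : r ∈ Q) (hs : s ∈ Q)
    (h : Derives (undefeated (TTrans Q nm) Y) (tpref (nm r) (nm s))) :
    Derives (undefeated (TTrans Q nm) Y) (Lit.neg (TAtom.old (OAtom.pref (nm s) (nm r)))) := by
  refine .intro (asRuleT nm r s) ⟨mem_TTrans.2 ⟨r, hr, ?_⟩, by simp [defeated, asRuleT]⟩
    (by simpa [asRuleT] using h)
  iterate 9 right
  exact ⟨s, hs, rfl⟩

end Construction

/-! ## Statically ordered programs -/

section Static

variable {α N : Type} {P : Set (ORule α N)} {nm : ORule α N → N}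
  {lt : ORule α N → ORule α N → Prop} {Y : Set (Lit (TAtom α N))}

theorem strictOn.wellFounded_flip {γ : Type} {S : Set γ} {r : γ → γ → Prop}
    (h : strictOn S r) (hS : S.Finite) : WellFounded (flip r) := by
  have : IsStrictOrder γ (flip r) :=
    { irrefl := h.2.2, trans := fun a b c hab hbc => h.2.1 c b a hbc hab }
  refine Subrelation.wf ?_ (Set.wellFoundedOn_iff.1 (hS.wellFoundedOn (r := flip r)))
  intro a b hab
  exact ⟨hab, (h.1 _ _ hab).2, (h.1 _ _ hab).1⟩

theorem subset_staticProg : P ⊆ staticProg P nm lt := Set.subset_union_left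

theorem prefFactO_mem_staticProg (hlt : strictOn P lt) {r s : ORule α N} (h : lt r s) :
    prefFactO nm r s ∈ staticProg P nm lt :=
  .inr ⟨r, (hlt.1 _ _ h).1, s, (hlt.1 _ _ h).2, h, rfl⟩

theorem prefFactO_notMem (hreg : ∀ r ∈ P, noPref r) {r s : ORule α N} :
    prefFactO nm r s ∉ P := by
  intro h
  obtain ⟨a, ha⟩ := hreg _ h (prefLit (nm r) (nm s)) (Set.mem_insert _ _)
  simp [prefLit, Lit.atom] at ha

theorem mem_of_mem_staticProg_of_regLitO {r : ORule α N} (hr : r ∈ staticProg P nm lt)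
    (h : regLitO r.head) : r ∈ P := by
  obtain hr | ⟨s, _, t, _, _, rfl⟩ := hr
  · exact hr
  · obtain ⟨a, ha⟩ := h
    simp [prefFactO, prefLit, Lit.atom] at ha

theorem regLitO_head (hreg : ∀ r ∈ P, noPref r) {r : ORule α N} (hr : r ∈ P) :
    regLitO r.head := hreg r hr _ (Set.mem_insert _ _)

theorem regLitO_bodyP (hreg : ∀ r ∈ P, noPref r) {r : ORule α N}
    (hr : r ∈ staticProg P nm lt) {L : Lit (OAtom α N)} (hL : L ∈ r.bodyP) : regLitO L := by
  obtain hr | ⟨s, _, t, _, _, rfl⟩ := hr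
  · exact hreg r hr _ (.inr (.inl hL))
  · exact hL.elim

theorem regLitO_bodyN (hreg : ∀ r ∈ P, noPref r) {r : ORule α N}
    (hr : r ∈ staticProg P nm lt) {L : Lit (OAtom α N)} (hL : L ∈ r.bodyN) : regLitO L := by
  obtain hr | ⟨s, _, t, _, _, rfl⟩ := hr
  · exact hreg r hr _ (.inr (.inr hL))
  · exact hL.elim

/-- The derivable preference literals are those prescribed by the static order. -/
theorem Derives.exists_lt (hreg : ∀ r ∈ P, noPref r) (hlt : strictOn P lt)
    (hinj : Set.InjOn nm (staticProg P nm lt)) {R : Set (Rule (TAtom α N))}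
    (hR : R ⊆ TTrans (staticProg P nm lt) nm) {n m : N} (h : Derives R (tpref n m)) :
    ∃ r s, lt r s ∧ nm r = n ∧ nm s = m := by
  generalize hL : tpref n m = L at h
  induction h generalizing n m with
  | intro ru hru hb ih =>
    obtain ⟨r, hr, rfl | rfl | rfl | ⟨K, hK, rfl⟩ | ⟨K, hK, rfl⟩ | ⟨s, hs, rfl⟩ | ⟨s, hs, rfl⟩ |
      ⟨s, hs, rfl⟩ | ⟨s, hs, t, ht, rfl⟩ | ⟨s, hs, rfl⟩⟩ := mem_TTrans.1 (hR hru)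
    case inl =>
      have hhead : prefLit n m = r.head := oldLit_injective hL
      obtain hr | ⟨s, _, t, _, hst, rfl⟩ := hr
      · obtain ⟨a, ha⟩ := regLitO_head hreg hr
        simp [← hhead, prefLit, Lit.atom] at ha
      · obtain ⟨rfl, rfl⟩ : n = nm s ∧ m = nm t := by simpa [prefFactO, prefLit] using hhead
        exact ⟨s, t, hst, rfl, rfl⟩
    case inr.inr.inr.inr.inr.inr.inr.inr.inl =>
      obtain ⟨rfl, rfl⟩ : n = nm r ∧ m = nm t := by simpa [tRuleT, tpref] using hL
      obtain ⟨a, b, hab, ha, hb⟩ := ih (tpref (nm r) (nm s)) (by simp [tRuleT]) rfl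
      obtain ⟨c, d, hcd, hc, hd⟩ := ih (tpref (nm s) (nm t)) (by simp [tRuleT]) rfl
      have hbc : b = c := hinj (subset_staticProg (hlt.1 _ _ hab).2)
        (subset_staticProg (hlt.1 _ _ hcd).1) (hb.trans hc.symm)
      exact ⟨a, d, hlt.2.1 _ _ _ hab (hbc ▸ hcd), ha, hd⟩
    all_goals
      simp [a2Rule, c1Rule, b1Rule, b2Rule, c2Rule, c3Rule, c4Rule, asRuleT, apLit, okLit,
        blLit, rdyLit, tpref] at hL

theorem derives_tpref (hreg : ∀ r ∈ P, noPref r) (hlt : strictOn P lt)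
    (hY : ∀ r ∈ staticProg P nm lt, ∀ s ∈ staticProg P nm lt,
      tpref (nm r) (nm s) ∈ Y → lt r s) {r s : ORule α N} (h : lt r s) :
    Derives (undefeated (TTrans (staticProg P nm lt) nm) Y) (tpref (nm r) (nm s)) := by
  have hf := prefFactO_mem_staticProg (nm := nm) hlt h
  refine derives_head_of_ap hf (derives_ap hf (derives_ok hf ?_) ?_ ?_)
  · intro t ht hp
    exact absurd (hlt.1 _ _ (hY _ hf _ ht hp)).1 (prefFactO_notMem hreg)
  · exact fun L hL => hL.elim
  · exact fun L hL => hL.elim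

theorem derives_ok_of_forall_lt (hreg : ∀ r ∈ P, noPref r) (hlt : strictOn P lt)
    (hY : ∀ r ∈ staticProg P nm lt, ∀ s ∈ staticProg P nm lt,
      tpref (nm r) (nm s) ∈ Y → lt r s) {r : ORule α N} (hr : r ∈ staticProg P nm lt)
    (h : ∀ s, lt r s →
      Derives (undefeated (TTrans (staticProg P nm lt) nm) Y) (apLit (nm s)) ∨
        Derives (undefeated (TTrans (staticProg P nm lt) nm) Y) (blLit (nm s))) :
    Derives (undefeated (TTrans (staticProg P nm lt) nm) Y) (okLit (nm r)) :=
  derives_ok hr fun s hs hp =>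
    ⟨derives_tpref hreg hlt hY (hY _ hr _ hs hp), h s (hY _ hr _ hs hp)⟩

end Static

section Forward

variable {α N : Type} {P : Set (ORule α N)} {nm : ORule α N → N}
  {lt : ORule α N → ORule α N → Prop} {X : Set (Lit (OAtom α N))}

/-- The answer set of `𝒯(P,lt)` that extends a `lt`-preserving answer set `X` of `P`. -/
def extendedSet (P : Set (ORule α N)) (nm : ORule α N → N)
    (lt : ORule α N → ORule α N → Prop) (X : Set (Lit (OAtom α N))) : Set (Lit (TAtom α N))
  | .pos (.old (.reg a)) => Lit.pos (OAtom.reg a) ∈ X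
  | .neg (.old (.reg a)) => Lit.neg (OAtom.reg a) ∈ X
  | .pos (.old (.pref n m)) => ∃ r s, lt r s ∧ nm r = n ∧ nm s = m
  | .neg (.old (.pref n m)) => ∃ r s, lt r s ∧ nm s = n ∧ nm r = m
  | .pos (.ap n) => ∃ r ∈ GR (staticProg P nm lt) X, nm r = n
  | .pos (.bl n) => ∃ r ∈ staticProg P nm lt, r ∉ GR (staticProg P nm lt) X ∧ nm r = n
  | .pos (.ok n) => ∃ r ∈ staticProg P nm lt, nm r = n
  | .pos (.rdy n m) => ∃ r ∈ staticProg P nm lt, ∃ s ∈ staticProg P nm lt, nm r = n ∧ nm s = m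
  | .neg _ => False

theorem oldLit_mem_extendedSet {L : Lit (OAtom α N)} (hL : regLitO L) :
    oldLit L ∈ extendedSet P nm lt X ↔ L ∈ X := by
  obtain ⟨a, ha⟩ := hL
  rcases L with b | b <;> obtain rfl : b = _ := ha <;> exact Iff.rfl

theorem lt_of_tpref_mem_extendedSet (hlt : strictOn P lt)
    (hinj : Set.InjOn nm (staticProg P nm lt)) {r s : ORule α N}
    (hr : r ∈ staticProg P nm lt) (hs : s ∈ staticProg P nm lt)
    (h : tpref (nm r) (nm s) ∈ extendedSet P nm lt X) : lt r s := by
  obtain ⟨r', s', hlt', hr', hs'⟩ := h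
  rwa [← hinj (subset_staticProg (hlt.1 _ _ hlt').1) hr hr',
    ← hinj (subset_staticProg (hlt.1 _ _ hlt').2) hs hs']

theorem consistent_extendedSet (hX : consistent X) (hlt : strictOn P lt)
    (hinj : Set.InjOn nm (staticProg P nm lt)) : consistent (extendedSet P nm lt X) := by
  rintro ⟨(⟨a⟩ | ⟨n, m⟩) | n | n | n | ⟨n, m⟩, hp, hn⟩
  · exact hX ⟨_, hp, hn⟩
  · obtain ⟨r, s, hrs, rfl, rfl⟩ := hn
    have hsr := lt_of_tpref_mem_extendedSet hlt hinj
      (subset_staticProg (hlt.1 _ _ hrs).2) (subset_staticProg (hlt.1 _ _ hrs).1) hp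
    exact hlt.2.2 _ (hlt.2.1 _ _ _ hrs hsr)
  all_goals exact hn

theorem Derives.mem_extendedSet (hreg : ∀ r ∈ P, noPref r) (hlt : strictOn P lt)
    (hinj : Set.InjOn nm (staticProg P nm lt))
    (hX : ∀ L, L ∈ X ↔ Derives (undefeated P X) L) {L : Lit (TAtom α N)}
    (h : Derives (undefeated (TTrans (staticProg P nm lt) nm) (extendedSet P nm lt X)) L) :
    L ∈ extendedSet P nm lt X := by
  induction h with
  | intro ru hru hb ih =>
    clear hb
    obtain ⟨hru, hd⟩ := hru
    obtain ⟨r, hr, rfl | rfl | rfl | ⟨K, hK, rfl⟩ | ⟨K, hK, rfl⟩ | ⟨s, hs, rfl⟩ | ⟨s, hs, rfl⟩ |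
      ⟨s, hs, rfl⟩ | ⟨s, hs, t, ht, rfl⟩ | ⟨s, hs, rfl⟩⟩ := mem_TTrans.1 hru
    · obtain ⟨r', hr', heq⟩ := ih (apLit (nm r)) rfl
      obtain rfl := hinj hr'.1 hr heq
      obtain hr | ⟨s, _, t, _, hst, rfl⟩ := hr
      · refine (oldLit_mem_extendedSet (regLitO_head hreg hr)).2 ((hX _).2 ?_)
        exact .intro r' ⟨hr, hr'.2.2⟩ fun L hL => (hX L).1 (hr'.2.1 hL)
      · exact ⟨s, t, hst, rfl, rfl⟩
    · refine ⟨r, ⟨hr, fun L hL => ?_, fun ⟨L, hL, hLX⟩ => hd ⟨oldLit L, ⟨L, hL, rfl⟩, ?_⟩⟩, rfl⟩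
      · exact (oldLit_mem_extendedSet (regLitO_bodyP hreg hr hL)).1
          (ih _ (Set.mem_insert_of_mem _ ⟨L, hL, rfl⟩))
      · exact (oldLit_mem_extendedSet (regLitO_bodyN hreg hr hL)).2 hLX
    · exact ⟨r, hr, rfl⟩
    · refine ⟨r, hr, fun hg => hd ⟨oldLit K, rfl, ?_⟩, rfl⟩
      exact (oldLit_mem_extendedSet (regLitO_bodyP hreg hr hK)).2 (hg.2.1 hK)
    · refine ⟨r, hr, fun hg => hg.2.2 ⟨K, hK, ?_⟩, rfl⟩
      exact (oldLit_mem_extendedSet (regLitO_bodyN hreg hr hK)).1 (ih _ (by simp [b2Rule]))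
    · exact ⟨r, hr, s, hs, rfl, rfl⟩
    · exact ⟨r, hr, s, hs, rfl, rfl⟩
    · exact ⟨r, hr, s, hs, rfl, rfl⟩
    · have hrs := lt_of_tpref_mem_extendedSet hlt hinj hr hs (ih _ (by simp [tRuleT]))
      have hst := lt_of_tpref_mem_extendedSet hlt hinj hs ht (ih _ (by simp [tRuleT]))
      exact ⟨r, t, hlt.2.1 _ _ _ hrs hst, rfl, rfl⟩
    · have hrs := lt_of_tpref_mem_extendedSet hlt hinj hr hs (ih _ rfl)
      exact ⟨r, s, hrs, rfl, rfl⟩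

theorem mem_GR_staticProg {r : ORule α N} (hr : r ∈ P) :
    r ∈ GR (staticProg P nm lt) X ↔ r ∈ GR P X :=
  ⟨fun h => ⟨hr, h.2⟩, fun h => ⟨subset_staticProg hr, h.2⟩⟩

theorem mem_headsBefore {γ : Type} {l : List (Rule γ)} {i : ℕ} {L : Lit γ} :
    L ∈ headsBefore l i ↔ ∃ k, ∃ h : k < l.length, k < i ∧ (l.get ⟨k, h⟩).head = L := by
  simp only [headsBefore, Set.mem_ofPred_eq, List.mem_map, List.mem_take_iff_getElem]
  constructor
  · rintro ⟨_, ⟨k, hk, rfl⟩, rfl⟩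
    exact ⟨k, by omega, by omega, rfl⟩
  · rintro ⟨k, hk, hki, rfl⟩
    exact ⟨_, ⟨k, by omega, rfl⟩, rfl⟩

theorem answerSet_extendedSet (hfin : P.Finite) (hreg : ∀ r ∈ P, noPref r)
    (hlt : strictOn P lt) (hinj : Set.InjOn nm (staticProg P nm lt))
    (h : staticPreserving P lt X) :
    answerSet (TStatic P nm lt) (extendedSet P nm lt X) := by
  obtain ⟨hans, hcons, l, ⟨-, henum⟩, hground, hord, hblock⟩ := h
  have hX := (answerSet_iff_of_consistent hcons).1 hans
  have hYlt : ∀ r ∈ staticProg P nm lt, ∀ s ∈ staticProg P nm lt,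
      tpref (nm r) (nm s) ∈ extendedSet P nm lt X → lt r s :=
    fun r hr s hs => lt_of_tpref_mem_extendedSet hlt hinj hr hs
  have hwf := hlt.wellFounded_flip hfin
  have hGR : ∀ {r}, r ∈ GR P X ↔ ∃ k, ∃ hk : k < l.length, l.get ⟨k, hk⟩ = r := by
    intro r
    rw [← henum, Set.mem_ofPred_eq, List.mem_iff_get]
    exact ⟨fun ⟨k, hk⟩ => ⟨k, k.2, hk⟩, fun ⟨k, hk, h⟩ => ⟨⟨k, hk⟩, h⟩⟩
  rw [answerSet_iff_of_consistent (consistent_extendedSet hcons hlt hinj)]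
  intro L
  refine ⟨fun hL => ?_, Derives.mem_extendedSet hreg hlt hinj hX⟩
  unfold TStatic
  set R := undefeated (TTrans (staticProg P nm lt) nm) (extendedSet P nm lt X)
  have hbl : ∀ {r}, r ∈ P → Derives R (okLit (nm r)) →
      (¬ r.bodyP ⊆ X ∨ ∃ L ∈ r.bodyN, Derives R (oldLit L)) → Derives R (blLit (nm r)) := by
    intro r hr hok hcase
    rcases hcase with hb | ⟨L, hL, hd⟩
    · obtain ⟨L, hL, hLX⟩ := Set.not_subset.1 hb
      exact derives_bl_of_notMem (subset_staticProg hr) hok hL fun hY =>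
        hLX ((oldLit_mem_extendedSet (hreg r hr L (.inr (.inl hL)))).1 hY)
    · exact derives_bl_of_derives (subset_staticProg hr) hok hL hd
  have hap : ∀ {r}, r ∈ GR P X → Derives R (okLit (nm r)) →
      (∀ L ∈ r.bodyP, Derives R (oldLit L)) → Derives R (apLit (nm r)) := by
    intro r hr hok hb
    exact derives_ap (subset_staticProg hr.1) hok hb fun L hL hY => hr.2.2 ⟨L, hL,
      (oldLit_mem_extendedSet (hreg r hr.1 L (.inr (.inr hL)))).1 hY⟩
  have hlist : ∀ (i : ℕ) (hi : i < l.length), Derives R (apLit (nm (l.get ⟨i, hi⟩))) := by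
    intro i
    induction i using Nat.strong_induction_on with
    | _ i ih =>
      intro hi
      have hheads : ∀ L ∈ headsBefore l i, Derives R (oldLit L) := by
        intro L hL
        obtain ⟨k, hk, hki, rfl⟩ := mem_headsBefore.1 hL
        exact derives_head_of_ap (subset_staticProg (hGR.2 ⟨k, hk, rfl⟩).1) (ih k hki hk)
      have habove : ∀ s, lt (l.get ⟨i, hi⟩) s →
          Derives R (apLit (nm s)) ∨ Derives R (blLit (nm s)) := by
        intro s
        induction s using hwf.induction with
        | _ s ihs =>
          intro his
          have hsP := (hlt.1 _ _ his).2
          by_cases hs : s ∈ GR P X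
          · obtain ⟨j, hj, rfl⟩ := hGR.1 hs
            exact .inl (ih j (hord i j hi hj his) hj)
          · have hok : Derives R (okLit (nm s)) :=
              derives_ok_of_forall_lt hreg hlt hYlt (subset_staticProg hsP) fun t hst =>
                ihs t hst (hlt.2.1 _ _ _ his hst)
            refine .inr (hbl hsP hok ((hblock i hi s hsP hs his).imp_right ?_))
            exact fun ⟨L, hL, hLh⟩ => ⟨L, hL, hheads L hLh⟩
      have hiG : l.get ⟨i, hi⟩ ∈ GR P X := hGR.2 ⟨i, hi, rfl⟩
      refine hap hiG ?_ fun L hL => hheads L (hground i hi hL)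
      exact derives_ok_of_forall_lt hreg hlt hYlt (subset_staticProg hiG.1) habove
  have hGRap : ∀ r ∈ GR P X, Derives R (apLit (nm r)) := by
    intro r hr
    obtain ⟨k, hk, rfl⟩ := hGR.1 hr
    exact hlist k hk
  have hXR : ∀ L ∈ X, Derives R (oldLit L) := by
    intro L hL
    obtain ⟨r, hr, rfl, hb⟩ := ((hX L).1 hL).exists_rule
    exact derives_head_of_ap (subset_staticProg hr.1)
      (hGRap r ⟨hr.1, fun K hK => (hX K).2 (hb K hK), hr.2⟩)
  have hXreg : ∀ L ∈ X, regLitO L := by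
    intro L hL
    obtain ⟨r, hr, rfl, -⟩ := ((hX L).1 hL).exists_rule
    exact regLitO_head hreg hr.1
  have hdecided : ∀ r, r ∈ P → Derives R (okLit (nm r)) ∧
      (r ∉ GR P X → Derives R (blLit (nm r))) := by
    intro r
    induction r using hwf.induction with
    | _ r ih =>
      intro hr
      have hok : Derives R (okLit (nm r)) := by
        refine derives_ok_of_forall_lt hreg hlt hYlt (subset_staticProg hr) fun s hrs => ?_
        have hs := (hlt.1 _ _ hrs).2
        by_cases hsG : s ∈ GR P X
        · exact .inl (hGRap s hsG)
        · exact .inr ((ih s hrs hs).2 hsG)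
      refine ⟨hok, fun hrG => hbl hr hok ?_⟩
      by_cases hb : r.bodyP ⊆ X
      · obtain ⟨L, hL, hLX⟩ : defeated r X := by
          by_contra hd
          exact hrG ⟨hr, hb, hd⟩
        exact .inr ⟨L, hL, hXR L hLX⟩
      · exact .inl hb
  have hpref : ∀ {r s}, lt r s → Derives R (tpref (nm r) (nm s)) :=
    fun hrs => derives_tpref hreg hlt hYlt hrs
  have hok : ∀ r ∈ staticProg P nm lt, Derives R (okLit (nm r)) := by
    intro r hr
    obtain hrP | ⟨s, _, t, _, hst, rfl⟩ := id hr
    · exact (hdecided r hrP).1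
    · exact derives_ok_of_forall_lt hreg hlt hYlt hr fun u hu =>
        absurd (hlt.1 _ _ hu).1 (prefFactO_notMem hreg)
  rcases L with ((⟨a⟩ | ⟨n, m⟩) | n | n | n | ⟨n, m⟩) | ((⟨a⟩ | ⟨n, m⟩) | n | n | n | ⟨n, m⟩)
  · exact hXR _ hL
  · obtain ⟨r, s, hrs, rfl, rfl⟩ := hL
    exact hpref hrs
  · obtain ⟨r, hr, rfl⟩ := hL
    obtain hrP | ⟨s, _, t, _, hst, rfl⟩ := id hr.1
    · exact hGRap r ((mem_GR_staticProg hrP).1 hr)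
    · exact derives_ap hr.1 (hok _ hr.1) (fun L hL => hL.elim) fun L hL => hL.elim
  · obtain ⟨r, hr, hrG, rfl⟩ := hL
    obtain hrP | ⟨s, _, t, _, hst, rfl⟩ := id hr
    · exact (hdecided r hrP).2 ((mem_GR_staticProg hrP).not.1 hrG)
    · exact absurd ⟨hr, fun L hL => hL.elim, fun ⟨L, hL, _⟩ => hL.elim⟩ hrG
  · obtain ⟨r, hr, rfl⟩ := hL
    exact hok r hr
  · obtain ⟨r, hr, s, hs, rfl, rfl⟩ := hL
    exact (hok r hr).ok_inv (fun _ h => h.1) s hs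
  · exact hXR _ hL
  · obtain ⟨r, s, hrs, rfl, rfl⟩ := hL
    exact derives_neg_pref (subset_staticProg (hlt.1 _ _ hrs).1)
      (subset_staticProg (hlt.1 _ _ hrs).2) (hpref hrs)
  all_goals exact hL.elim

end Forward

section Backward

/-- A finite set can be enumerated greedily, as long as every incomplete initial segment can be
extended by an element that is good for it. -/
theorem exists_list_of_forall_extend {γ : Type} {G : Set γ} (hG : G.Finite)
    (good : List γ → γ → Prop)
    (hext : ∀ l : List γ, (∀ a ∈ l, a ∈ G) → (∃ a ∈ G, a ∉ l) → ∃ a ∈ G, a ∉ l ∧ good l a) :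
    ∃ l : List γ, l.Nodup ∧ (∀ a, a ∈ l ↔ a ∈ G) ∧
      ∀ (i : ℕ) (h : i < l.length), good (l.take i) (l.get ⟨i, h⟩) := by
  classical
  by_contra hno
  have hlen : ∀ n : ℕ, ∃ l : List γ, l.length = n ∧ l.Nodup ∧ (∀ a ∈ l, a ∈ G) ∧
      ∀ (i : ℕ) (h : i < l.length), good (l.take i) (l.get ⟨i, h⟩) := by
    intro n
    induction n with
    | zero => exact ⟨[], by simp⟩
    | succ n ih =>
      obtain ⟨l, rfl, hnd, hsub, hgood⟩ := ih
      have hmiss : ∃ a ∈ G, a ∉ l := by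
        by_contra! hall
        exact hno ⟨l, hnd, fun a => ⟨hsub a, hall a⟩, hgood⟩
      obtain ⟨a, haG, hal, ha⟩ := hext l hsub hmiss
      refine ⟨l ++ [a], by simp, ?_, ?_, ?_⟩
      · rw [← List.concat_eq_append]
        exact hnd.concat hal
      · intro b hb
        rcases List.mem_append.1 hb with hb | hb
        · exact hsub b hb
        · rwa [List.mem_singleton.1 hb]
      · intro i hi
        rcases Nat.lt_or_ge i l.length with hil | hil
        · simpa [List.take_append_of_le_length hil.le, List.getElem_append_left hil]
            using hgood i hil
        · obtain rfl : i = l.length := by simp at hi; omega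
          simpa using ha
  obtain ⟨l, hl, hnd, hsub, -⟩ := hlen (hG.toFinset.card + 1)
  have hle : l.toFinset.card ≤ hG.toFinset.card :=
    Finset.card_le_card fun a ha => hG.mem_toFinset.2 (hsub a (List.mem_toFinset.1 ha))
  rw [List.toFinset_card_of_nodup hnd] at hle
  omega

variable {α N : Type} {P : Set (ORule α N)} {nm : ORule α N → N}
  {lt : ORule α N → ORule α N → Prop} {X : Set (Lit (OAtom α N))} {Y : Set (Lit (TAtom α N))}

theorem staticPreserving_of_answerSet (hfin : P.Finite) (hreg : ∀ r ∈ P, noPref r)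
    (hlt : strictOn P lt) (hinj : Set.InjOn nm (staticProg P nm lt)) (hcons : consistent X)
    (hYcons : consistent Y) (hans : answerSet (TStatic P nm lt) Y)
    (hXY : Lit.map TAtom.old '' X = Y ∩ regLitsT) : staticPreserving P lt X := by
  have hY := (answerSet_iff_of_consistent hYcons).1 hans
  unfold TStatic at hY
  set R := undefeated (TTrans (staticProg P nm lt) nm) Y
  have hRT : R ⊆ TTrans (staticProg P nm lt) nm := fun _ h => h.1
  have hold : ∀ {L}, regLitO L → (oldLit L ∈ Y ↔ L ∈ X) := by
    intro L hL
    constructor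
    · intro h
      obtain ⟨K, hK, hKL⟩ := hXY.ge ⟨h, oldLit_mem_regLitsT.2 hL⟩
      rwa [← oldLit_injective hKL]
    · exact fun h => (hXY.le ⟨L, h, rfl⟩).1
  have hXreg : ∀ L ∈ X, regLitO L := fun L hL =>
    oldLit_mem_regLitsT.1 (hXY.le ⟨L, hL, rfl⟩).2
  have hYlt : ∀ r ∈ staticProg P nm lt, ∀ s ∈ staticProg P nm lt,
      tpref (nm r) (nm s) ∈ Y → lt r s := by
    intro r hr s hs h
    obtain ⟨r', s', hlt', hr', hs'⟩ := ((hY _).1 h).exists_lt hreg hlt hinj hRT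
    rwa [← hinj (subset_staticProg (hlt.1 _ _ hlt').1) hr hr',
      ← hinj (subset_staticProg (hlt.1 _ _ hlt').2) hs hs']
  have hGR : ∀ {r}, r ∈ P → a2Rule nm r ∈ R → (∀ L ∈ r.bodyP, oldLit L ∈ Y) → r ∈ GR P X := by
    intro r hr ha hb
    refine ⟨hr, fun L hL => ?_, fun ⟨L, hL, hLX⟩ => ha.2 ⟨oldLit L, ⟨L, hL, rfl⟩, ?_⟩⟩
    · exact (hold (hreg r hr L (.inr (.inl hL)))).1 (hb L hL)
    · exact (hold (hXreg L hLX)).2 hLX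
  have hap_GR : ∀ {r}, r ∈ P → apLit (nm r) ∈ Y → r ∈ GR P X := by
    intro r hr h
    obtain ⟨r', hr', heq, ha, -, hb⟩ := ((hY _).1 h).ap_inv hRT
    obtain rfl := hinj hr' (subset_staticProg hr) heq
    exact hGR hr ha fun L hL => (hY _).2 (hb L hL)
  have hbl_GR : ∀ {r}, r ∈ P → blLit (nm r) ∈ Y → r ∉ GR P X := by
    intro r hr h hg
    obtain ⟨r', hr', heq, ⟨L, hL, hb⟩ | ⟨L, hL, hd⟩⟩ := ((hY _).1 h).bl_inv hRT
    · obtain rfl := hinj hr' (subset_staticProg hr) heq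
      exact hb.2 ⟨oldLit L, rfl, (hold (hXreg L (hg.2.1 hL))).2 (hg.2.1 hL)⟩
    · obtain rfl := hinj hr' (subset_staticProg hr) heq
      exact hg.2.2 ⟨L, hL, (hold (regLitO_bodyN hreg hr' hL)).1 ((hY _).2 hd)⟩
  have hdecided : ∀ r, r ∈ P → Derives R (apLit (nm r)) ∨ Derives R (blLit (nm r)) := by
    intro r
    induction r using (hlt.wellFounded_flip hfin).induction with
    | _ r ih =>
      intro hr
      have hok : Derives R (okLit (nm r)) :=
        derives_ok_of_forall_lt hreg hlt hYlt (subset_staticProg hr) fun s hrs =>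
          ih s hrs (hlt.1 _ _ hrs).2
      by_cases hb : ∀ L ∈ r.bodyP, oldLit L ∈ Y
      · by_cases hn : ∀ L ∈ r.bodyN, oldLit L ∉ Y
        · exact .inl (derives_ap (subset_staticProg hr) hok (fun L hL => (hY _).1 (hb L hL)) hn)
        · push Not at hn
          obtain ⟨L, hL, hLY⟩ := hn
          exact .inr (derives_bl_of_derives (subset_staticProg hr) hok hL ((hY _).1 hLY))
      · push Not at hb
        obtain ⟨L, hL, hLY⟩ := hb
        exact .inr (derives_bl_of_notMem (subset_staticProg hr) hok hL hLY)
  have hGR_ap : ∀ {r}, r ∈ GR P X → Derives R (apLit (nm r)) := by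
    intro r hr
    exact (hdecided r hr.1).resolve_right fun h => hbl_GR hr.1 ((hY _).2 h) hr
  let good (l : List (ORule α N)) (r : ORule α N) : Prop :=
    (∀ L ∈ r.bodyP, L ∈ l.map Rule.head) ∧ (∀ s ∈ GR P X, lt r s → s ∈ l) ∧
      ∀ s ∈ P, s ∉ GR P X → lt r s →
        ¬ s.bodyP ⊆ X ∨ ∃ L ∈ s.bodyN, L ∈ l.map Rule.head
  obtain ⟨l, hnd, hmem, hgood⟩ := exists_list_of_forall_extend
    (hfin.subset fun r (hr : r ∈ GR P X) => hr.1) good (by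
      intro l hl ⟨r₀, hr₀, hr₀l⟩
      -- derivations that apply only the rules already listed
      let S : Set (Rule (TAtom α N)) := {ru | ru ∈ R ∧ ∀ r ∈ P, ru = a2Rule nm r → r ∈ l}
      have hSR : S ⊆ R := fun _ h => h.1
      have hST : S ⊆ TTrans (staticProg P nm lt) nm := hSR.trans hRT
      have hSY : ∀ {L}, Derives S L → L ∈ Y := fun h => (hY _).2 (h.mono hSR)
      have hSap : ∀ {r}, r ∈ P → Derives S (apLit (nm r)) → r ∈ l := by
        intro r hr h
        obtain ⟨r', hr', heq, ha, -⟩ := h.ap_inv hST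
        obtain rfl := hinj hr' (subset_staticProg hr) heq
        exact ha.2 _ hr rfl
      have hSreg : ∀ {L}, regLitO L → Derives S (oldLit L) → L ∈ l.map Rule.head := by
        intro L hL h
        obtain ⟨r, hr, rfl, ha⟩ := h.reg_inv hST hL
        exact List.mem_map_of_mem (hSap (mem_of_mem_staticProg_of_regLitO hr hL) ha)
      obtain ⟨r, hr, hrl, hok, hb⟩ : ∃ r ∈ GR P X, r ∉ l ∧ Derives S (okLit (nm r)) ∧
          ∀ L ∈ r.bodyP, Derives S (oldLit L) := by
        by_contra! hno
        have hall : ∀ L, Derives R L → Derives S L := by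
          intro L hL
          induction hL with
          | intro ru hru _ ih =>
            refine .intro ru ⟨hru, ?_⟩ ih
            rintro r hr rfl
            by_contra hrl
            have hb : ∀ L ∈ r.bodyP, Derives S (oldLit L) := fun L hL =>
              ih _ (Set.mem_insert_of_mem _ ⟨L, hL, rfl⟩)
            obtain ⟨L, hL, hLS⟩ := hno r (hGR hr hru fun L hL => hSY (hb L hL)) hrl
              (ih _ (Set.mem_insert _ _))
            exact hLS (hb L hL)
        exact hr₀l (hSap hr₀.1 (hall _ (hGR_ap hr₀)))
      have habove : ∀ s, lt r s → Derives S (apLit (nm s)) ∨ Derives S (blLit (nm s)) := by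
        intro s hrs
        have hs := (hlt.1 _ _ hrs).2
        refine (((hok.ok_inv hST s (subset_staticProg hs)).rdy_inv hST).resolve_left ?_)
        rintro ⟨r', s', hr', hs', hc⟩
        refine hc.1.2 ⟨tpref (nm r) (nm s), ?_, ?_⟩
        · rw [← hr', ← hs']
          rfl
        · exact (hY _).2 (derives_tpref hreg hlt hYlt hrs)
      refine ⟨r, hr, hrl, fun L hL => hSreg (hXreg L (hr.2.1 hL)) (hb L hL), ?_, ?_⟩
      · intro s hs hrs
        exact hSap hs.1 ((habove s hrs).resolve_right fun h => hbl_GR hs.1 (hSY h) hs)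
      · intro s hs hsG hrs
        have hbl := (habove s hrs).resolve_left fun h => hsG (hap_GR hs (hSY h))
        obtain ⟨s', hs', heq, ⟨L, hL, hc⟩ | ⟨L, hL, hd⟩⟩ := hbl.bl_inv hST
        · obtain rfl := hinj hs' (subset_staticProg hs) heq
          refine .inl fun hsub => hc.1.2 ⟨oldLit L, rfl, ?_⟩
          exact (hold (hXreg L (hsub hL))).2 (hsub hL)
        · obtain rfl := hinj hs' (subset_staticProg hs) heq
          exact .inr ⟨L, hL, hSreg (regLitO_bodyN hreg hs' hL) hd⟩)
  have hlist : ∀ (i : ℕ) (hi : i < l.length),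
      Derives (undefeated P X) (l.get ⟨i, hi⟩).head := by
    intro i
    induction i using Nat.strong_induction_on with
    | _ i ih =>
      intro hi
      have hiG := (hmem _).1 (List.get_mem l ⟨i, hi⟩)
      refine .intro _ ⟨hiG.1, hiG.2.2⟩ fun L hL => ?_
      obtain ⟨k, hk, hki, rfl⟩ := mem_headsBefore.1 ((hgood i hi).1 L hL)
      exact ih k hki hk
  have hXans : answerSet P X := by
    refine (answerSet_iff_of_consistent hcons).2 fun L => ⟨fun hL => ?_, fun hL => ?_⟩
    · have hLreg := hXreg L hL
      obtain ⟨r, hr, rfl, hap⟩ := ((hY _).1 ((hold hLreg).2 hL)).reg_inv hRT hLreg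
      have hrP := mem_of_mem_staticProg_of_regLitO hr hLreg
      obtain ⟨⟨k, hk⟩, rfl⟩ := List.mem_iff_get.1 ((hmem r).2 (hap_GR hrP ((hY _).2 hap)))
      exact hlist k hk
    · induction hL with
      | intro r hr _ ih =>
        have hrG : r ∈ GR P X := ⟨hr.1, ih, hr.2⟩
        exact (hold (regLitO_head hreg hr.1)).1
          ((hY _).2 (derives_head_of_ap (subset_staticProg hr.1) (hGR_ap hrG)))
  refine ⟨hXans, hcons, l, ⟨hnd, Set.ext hmem⟩, ?_, ?_, ?_⟩
  · exact fun i hi => (hgood i hi).1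
  · intro i j hi hj hij
    have hmem' := (hgood i hi).2.1 _ ((hmem _).1 (List.get_mem l ⟨j, hj⟩)) hij
    obtain ⟨k, hk, hkj⟩ := List.mem_take_iff_getElem.1 hmem'
    have : k = j := (hnd.getElem_inj_iff).1 hkj
    omega
  · exact fun i hi => (hgood i hi).2.2

end Backward

theorem stmt8 {α N : Type} (P : Set (ORule α N)) (nm : ORule α N → N)
    (lt : ORule α N → ORule α N → Prop)
    (hfin : P.Finite) (hreg : ∀ r ∈ P, noPref r) (hlt : strictOn P lt)
    (hnm : Set.BijOn nm (staticProg P nm lt) Set.univ)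
    (X : Set (Lit (OAtom α N))) (hX : consistent X) :
    staticPreserving P lt X ↔
      ∃ Y, answerSet (TStatic P nm lt) Y ∧
        Lit.map TAtom.old '' X = Y ∩ regLitsT := by
  constructor
  · intro h
    refine ⟨extendedSet P nm lt X, answerSet_extendedSet hfin hreg hlt hnm.injOn h, ?_⟩
    have hXreg : ∀ L ∈ X, regLitO L := by
      intro L hL
      obtain ⟨r, hr, rfl, -⟩ :=
        (((answerSet_iff_of_consistent hX).1 h.1 L).1 hL).exists_rule
      exact regLitO_head hreg hr.1
    ext L
    constructor
    · rintro ⟨K, hK, rfl⟩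
      exact ⟨(oldLit_mem_extendedSet (hXreg K hK)).2 hK, oldLit_mem_regLitsT.2 (hXreg K hK)⟩
    · rintro ⟨hL, a, ha⟩
      rcases L with b | b <;> obtain rfl : b = _ := ha
      · exact ⟨.pos (.reg a), hL, rfl⟩
      · exact ⟨.neg (.reg a), hL, rfl⟩
  · rintro ⟨Y, hY, hXY⟩
    refine staticPreserving_of_answerSet hfin hreg hlt hnm.injOn hX ?_ hY hXY
    by_contra hYc
    have huniv := hY.eq_univ hYc
    -- with no regular atoms there are no rules, hence no names and no literals at all
    rcases isEmpty_or_nonempty α with hα | ⟨⟨a⟩⟩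
    · have hP : ∀ r, r ∉ P := fun r hr => (regLitO_head hreg hr).elim fun a _ => hα.false a
      have hN : N → False := fun n => by
        obtain ⟨r, hr | ⟨s, hs, -⟩, -⟩ := hnm.surjOn (Set.mem_univ n)
        · exact hP r hr
        · exact hP s hs
      refine hYc ?_
      rintro ⟨(⟨a⟩ | ⟨n, -⟩) | n | n | n | ⟨n, -⟩, -⟩
      · exact hα.false a
      all_goals exact hN n
    · have hmem : ∀ L : Lit (OAtom α N), regLitO L → L ∈ X := by
        intro L hL
        obtain ⟨K, hK, hKL⟩ := hXY.ge
          ⟨huniv ▸ Set.mem_univ (oldLit L), oldLit_mem_regLitsT.2 hL⟩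
        rwa [← oldLit_injective hKL]
      exact hX ⟨.reg a, hmem _ ⟨a, rfl⟩, hmem _ ⟨a, rfl⟩⟩

end ASP
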